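/- If A^SS(w) = A^NTLO(w) for some w, then every w-element subset of {1,…,n} that is a stopping set of the CSS code is the support of some NTLO. -/

import Mathlib

/-- Support of a vector over 𝔽₂, as a finset of coordinates. -/
def supp {n : ℕ} (v : Fin n → ZMod 2) : Finset (Fin n) :=
  Finset.univ.filter (fun j => v j ≠ 0)

/-- `S` is a stopping set of `H`: `S` is nonempty and every check with at least one
neighbor in `S` has at least two neighbors in `S`. -/
def IsStoppingSet {m n : ℕ} (H : Matrix (Fin m) (Fin n) (ZMod 2)) (S : Finset (Fin n)) : Prop :=
  S.Nonempty ∧ ∀ i : Fin m,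
    1 ≤ (S.filter (fun j => H i j = 1)).card → 2 ≤ (S.filter (fun j => H i j = 1)).card

/-- Check `i` is dangling for the erasure set `E`: exactly one `j ∈ E` has `H i j = 1`. -/
def Dangling {m n : ℕ} (H : Matrix (Fin m) (Fin n) (ZMod 2)) (E : Finset (Fin n))
    (i : Fin m) : Prop :=
  (E.filter (fun j => H i j = 1)).card = 1

/-- A peel step: some check `i` is dangling for `E` with unique erased neighbor `j`,
which is removed from `E`. -/
def PeelStep {m n : ℕ} (H : Matrix (Fin m) (Fin n) (ZMod 2)) (E E' : Finset (Fin n)) : Prop :=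
  ∃ i : Fin m, ∃ j ∈ E, E.filter (fun j' => H i j' = 1) = {j} ∧ E' = E.erase j

/-- A guess step: permitted only when no check is dangling for `E`; removes an
arbitrary single element of `E`. -/
def GuessStep {m n : ℕ} (H : Matrix (Fin m) (Fin n) (ZMod 2)) (E E' : Finset (Fin n)) : Prop :=
  (∀ i : Fin m, ¬ Dangling H E i) ∧ ∃ j ∈ E, E' = E.erase j

/-- A Maxwell step is a peel step or a guess step. -/
def MaxwellStep {m n : ℕ} (H : Matrix (Fin m) (Fin n) (ZMod 2)) (E E' : Finset (Fin n)) : Prop :=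
  PeelStep H E E' ∨ GuessStep H E E'

/-- A Maxwell trace from `E`: a finite sequence of peel/guess steps transforming `E`
into the empty set. -/
def IsMaxwellTrace {m n : ℕ} (H : Matrix (Fin m) (Fin n) (ZMod 2)) (E : Finset (Fin n))
    (k : ℕ) (f : Fin (k+1) → Finset (Fin n)) : Prop :=
  f 0 = E ∧ f (Fin.last k) = ∅ ∧ ∀ i : Fin k, MaxwellStep H (f i.castSucc) (f i.succ)

/-- Number of guess steps in a trace: the steps starting from a state with no
dangling check (these are exactly the guess steps). -/
noncomputable def guessCount {m n : ℕ} (H : Matrix (Fin m) (Fin n) (ZMod 2)) {k : ℕ}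
    (f : Fin (k+1) → Finset (Fin n)) : ℕ :=
  Nat.card {i : Fin k // ∀ c : Fin m, ¬ Dangling H (f i.castSucc) c}

/-- Row space of `H`: the 𝔽₂-span of the rows of `H` in 𝔽₂ⁿ. -/
def rowSpace {m n : ℕ} (H : Matrix (Fin m) (Fin n) (ZMod 2)) :
    Submodule (ZMod 2) (Fin n → ZMod 2) :=
  Submodule.span (ZMod 2) (Set.range fun i => H i)

/-- Nontrivial logical operator of the CSS code `(HX, HZ)`. -/
def IsNTLO {mX mZ n : ℕ} (HX : Matrix (Fin mX) (Fin n) (ZMod 2))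
    (HZ : Matrix (Fin mZ) (Fin n) (ZMod 2)) (v : Fin n → ZMod 2) : Prop :=
  v ≠ 0 ∧ ((HZ.mulVec v = 0 ∧ v ∉ rowSpace HX) ∨ (HX.mulVec v = 0 ∧ v ∉ rowSpace HZ))

/-- A stopping set of the CSS code: a stopping set of `HX` or of `HZ`. -/
def IsCSSStoppingSet {mX mZ n : ℕ} (HX : Matrix (Fin mX) (Fin n) (ZMod 2))
    (HZ : Matrix (Fin mZ) (Fin n) (ZMod 2)) (S : Finset (Fin n)) : Prop :=
  IsStoppingSet HX S ∨ IsStoppingSet HZ S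

/-- `ASS w`: number of `w`-element subsets of coordinates that are stopping sets
of the CSS code. -/
noncomputable def ASS {mX mZ n : ℕ} (HX : Matrix (Fin mX) (Fin n) (ZMod 2))
    (HZ : Matrix (Fin mZ) (Fin n) (ZMod 2)) (w : ℕ) : ℕ :=
  Nat.card {S : Finset (Fin n) // S.card = w ∧ IsCSSStoppingSet HX HZ S}

/-- `ANTLO w`: number of `w`-element subsets of coordinates that are the support of
some nontrivial logical operator. -/
noncomputable def ANTLO {mX mZ n : ℕ} (HX : Matrix (Fin mX) (Fin n) (ZMod 2))
    (HZ : Matrix (Fin mZ) (Fin n) (ZMod 2)) (w : ℕ) : ℕ :=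
  Nat.card {S : Finset (Fin n) // S.card = w ∧ ∃ v, IsNTLO HX HZ v ∧ supp v = S}

/-- `W0 t = {w : 0 < w ≤ t and ASS w > ANTLO w}`. -/
noncomputable def W0 {mX mZ n : ℕ} (HX : Matrix (Fin mX) (Fin n) (ZMod 2))
    (HZ : Matrix (Fin mZ) (Fin n) (ZMod 2)) (t : ℕ) : Finset ℕ :=
  (Finset.range (t+1)).filter (fun w => 0 < w ∧ ANTLO HX HZ w < ASS HX HZ w)

/-- The distribution gap `γ(t) = |W0(t)|`. -/
noncomputable def gam {mX mZ n : ℕ} (HX : Matrix (Fin mX) (Fin n) (ZMod 2))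
    (HZ : Matrix (Fin mZ) (Fin n) (ZMod 2)) (t : ℕ) : ℕ :=
  (W0 HX HZ t).card

/-- `F_ML`: erasure sets containing the support of some NTLO. -/
def FML {mX mZ n : ℕ} (HX : Matrix (Fin mX) (Fin n) (ZMod 2))
    (HZ : Matrix (Fin mZ) (Fin n) (ZMod 2)) : Set (Finset (Fin n)) :=
  {E | ∃ v, IsNTLO HX HZ v ∧ supp v ⊆ E}

/-- `F_QM(G)`: erasure sets admitting some Maxwell trace (with respect to `HZ` or to
`HX`) with more than `G` guess steps. -/
def FQM {mX mZ n : ℕ} (HX : Matrix (Fin mX) (Fin n) (ZMod 2))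
    (HZ : Matrix (Fin mZ) (Fin n) (ZMod 2)) (G : ℕ) : Set (Finset (Fin n)) :=
  {E | (∃ (k : ℕ) (f : Fin (k+1) → Finset (Fin n)),
          IsMaxwellTrace HZ E k f ∧ G < guessCount HZ f) ∨
       (∃ (k : ℕ) (f : Fin (k+1) → Finset (Fin n)),
          IsMaxwellTrace HX E k f ∧ G < guessCount HX f)}

open Classical in
/-- `P_F(ε) = Σ_{E ∈ F} ε^{|E|} (1-ε)^{n-|E|}`. -/
noncomputable def Pfail (n : ℕ) (F : Set (Finset (Fin n))) (ε : ℝ) : ℝ :=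
  ∑ E ∈ Finset.univ.filter (fun E : Finset (Fin n) => E ∈ F),
    ε ^ E.card * (1 - ε) ^ (n - E.card)

/-- The support of a nonzero vector in the kernel of `H` is a stopping set of `H`. -/
theorem isStoppingSet_supp {m n : ℕ} {H : Matrix (Fin m) (Fin n) (ZMod 2)}
    {v : Fin n → ZMod 2} (hv : v ≠ 0) (hH : H.mulVec v = 0) : IsStoppingSet H (supp v) := by
  refine ⟨?_, fun i hi => ?_⟩
  · obtain ⟨j, hj⟩ := Function.ne_iff.mp hv
    exact ⟨j, by simpa [supp] using hj⟩
  · by_contra hlt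
    obtain ⟨j, hj⟩ := Finset.card_eq_one.mp
      (show ((supp v).filter (fun j => H i j = 1)).card = 1 by omega)
    have hmem : ∀ k, (v k ≠ 0 ∧ H i k = 1) ↔ k = j := fun k => by
      simpa [supp] using Finset.ext_iff.mp hj k
    have hsum : ∑ k, H i k * v k = 0 := congrFun hH i
    rw [Finset.sum_eq_single j] at hsum
    · obtain ⟨hvj, hHj⟩ := (hmem j).mpr rfl
      exact hvj (by simpa [hHj] using hsum)
    · intro k _ hk
      have hbit : ∀ a b : ZMod 2, ¬(b ≠ 0 ∧ a = 1) → a * b = 0 := by decide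
      exact hbit _ _ (mt (hmem k).mp hk)
    · simp

/-- The support of a nontrivial logical operator is a stopping set of the CSS code. -/
theorem IsNTLO.isCSSStoppingSet_supp {mX mZ n : ℕ} {HX : Matrix (Fin mX) (Fin n) (ZMod 2)}
    {HZ : Matrix (Fin mZ) (Fin n) (ZMod 2)} {v : Fin n → ZMod 2} (hv : IsNTLO HX HZ v) :
    IsCSSStoppingSet HX HZ (supp v) := by
  obtain ⟨hne, ⟨hZ, -⟩ | ⟨hX, -⟩⟩ := hv
  · exact Or.inr (isStoppingSet_supp hne hZ)
  · exact Or.inl (isStoppingSet_supp hne hX)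

/-- If `ASS w = ANTLO w`, then every `w`-element stopping set of the CSS
code is the support of some NTLO. -/
theorem count_eq_implies_stopping_sets_are_ntlo_supports {mX mZ n : ℕ}
    (HX : Matrix (Fin mX) (Fin n) (ZMod 2)) (HZ : Matrix (Fin mZ) (Fin n) (ZMod 2))
    (hCSS : HX * HZ.transpose = 0) (w : ℕ) (h : ASS HX HZ w = ANTLO HX HZ w) :
    ∀ S : Finset (Fin n), S.card = w → IsCSSStoppingSet HX HZ S →
      ∃ v, IsNTLO HX HZ v ∧ supp v = S := by
  intro S hcard hS
  let stopping : Set (Finset (Fin n)) := {S | S.card = w ∧ IsCSSStoppingSet HX HZ S}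
  let logical : Set (Finset (Fin n)) := {S | S.card = w ∧ ∃ v, IsNTLO HX HZ v ∧ supp v = S}
  have hsub : logical ⊆ stopping := by
    rintro _ ⟨hc, v, hv, rfl⟩
    exact ⟨hc, hv.isCSSStoppingSet_supp⟩
  have hle : stopping.ncard ≤ logical.ncard := h.le
  have heq : logical = stopping := Set.eq_of_subset_of_ncard_le hsub hle
  have hmem : S ∈ logical := heq ▸ (⟨hcard, hS⟩ : S ∈ stopping)
  exact hmem.2
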